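/- (Sufficiency core of the BRP test: relative optimality implies global optimality.) Let X, A be finite nonempty sets, μ a prior on X, p_1,…,p_K stochastic kernels from X to A, u_1,…,u_K : X × A → ℝ utilities and c_1,…,c_K ∈ ℝ. Suppose each joint q_k(x,a) = μ(x) p_k(a|x) satisfies NIAS for u_k and q_1,…,q_K, u_1,…,u_K, c_1,…,c_K satisfy NIAC. Define C(p) = max_{1≤j≤K} [ c_j + J_A(μ, p, u_j) − J_A(μ, p_j, u_j) ]. Then for every k and every stochastic kernel p from X to A, J_A(μ, p_k, u_k) − C(p_k) ≥ J_A(μ, p, u_k) − C(p); i.e., each p_k globally maximizes expected utility net of the reconstructed information acquisition cost. -/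

import Mathlib

open Finset

/-- A stochastic kernel from `S` to `T`: `κ s t` is the probability of `t` given `s`. -/
def IsKernel {S T : Type*} [Fintype T] (κ : S → T → ℝ) : Prop :=
  (∀ s t, 0 ≤ κ s t) ∧ ∀ s, ∑ t, κ s t = 1

/-- A prior on a finite set `X`. -/
def IsPrior {X : Type*} [Fintype X] (μ : X → ℝ) : Prop :=
  (∀ x, 0 ≤ μ x) ∧ ∑ x, μ x = 1

/-- Maximum of a real-valued function over a finite nonempty type. -/
noncomputable def maxOver {A : Type*} [Fintype A] [Nonempty A] (f : A → ℝ) : ℝ :=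
  Finset.univ.sup' Finset.univ_nonempty f

/-- Maximal expected utility of attention strategy `α` under prior `μ` and utility `u`. -/
noncomputable def J {X Y A : Type*} [Fintype X] [Fintype Y] [Fintype A] [Nonempty A]
    (μ : X → ℝ) (α : X → Y → ℝ) (u : X → A → ℝ) : ℝ :=
  ∑ y, maxOver (fun a => ∑ x, μ x * α x y * u x a)

/-- Maximal expected utility of a direct strategy `p : X → A`. -/
noncomputable def JA {X A : Type*} [Fintype X] [Fintype A] [Nonempty A]
    (μ : X → ℝ) (p : X → A → ℝ) (u : X → A → ℝ) : ℝ :=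
  ∑ a, maxOver (fun b => ∑ x, μ x * p x a * u x b)

/-- `β` is an optimal decision rule for `(μ, α, u)`. -/
def OptimalRule {X Y A : Type*} [Fintype X] (μ : X → ℝ) (α : X → Y → ℝ)
    (u : X → A → ℝ) (β : Y → A → ℝ) : Prop :=
  ∀ y a, 0 < β y a → ∀ b, ∑ x, μ x * α x y * u x b ≤ ∑ x, μ x * α x y * u x a

/-- The NIAS (No-Improving-Action-Switches) inequalities. -/
def NIAS {X A : Type*} [Fintype X] (q u : X → A → ℝ) : Prop :=
  ∀ a b, ∑ x, q x a * (u x b - u x a) ≤ 0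

/-- The NIAC (No-Improving-Action-Cycles) inequalities for a collection of agents. -/
def NIAC {K X A : Type*} [Fintype X] [Fintype A] [Nonempty A]
    (q u : K → X → A → ℝ) (c : K → ℝ) : Prop :=
  ∀ j k, (∑ a, maxOver (fun b => ∑ x, q j x a * u k x b)) - c j
    - (∑ x, ∑ a, q k x a * u k x a) + c k ≤ 0

/-- The reconstructed information acquisition cost (BRP test). -/
noncomputable def reconCost {X A K : Type*} [Fintype X] [Fintype A] [Nonempty A]
    [Fintype K] [Nonempty K]
    (μ : X → ℝ) (p : K → X → A → ℝ) (u : K → X → A → ℝ) (c : K → ℝ)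
    (p' : X → A → ℝ) : ℝ :=
  maxOver (fun k => c k + JA μ p' (u k) - JA μ (p k) (u k))

lemma le_maxOver {A : Type*} [Fintype A] [Nonempty A] (f : A → ℝ) (a : A) : f a ≤ maxOver f :=
  Finset.le_sup' f (Finset.mem_univ a)

lemma maxOver_le {A : Type*} [Fintype A] [Nonempty A] {f : A → ℝ} {r : ℝ} (h : ∀ a, f a ≤ r) :
    maxOver f ≤ r :=
  Finset.sup'_le _ _ fun a _ => h a

/-- Following the recommended action yields at most the maximal expected utility. -/
lemma sum_mul_le_JA {X A : Type*} [Fintype X] [Fintype A] [Nonempty A]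
    (μ : X → ℝ) (p u : X → A → ℝ) :
    ∑ x, ∑ a, μ x * p x a * u x a ≤ JA μ p u := by
  rw [Finset.sum_comm]
  exact Finset.sum_le_sum fun a _ => le_maxOver (fun b => ∑ x, μ x * p x a * u x b) a

/-- Under NIAC, the reconstructed cost of an observed strategy is at most its assigned cost. -/
lemma reconCost_le_of_NIAC {X A K : Type*} [Fintype X] [Fintype A] [Nonempty A]
    [Fintype K] [Nonempty K] {μ : X → ℝ} {p u : K → X → A → ℝ} {c : K → ℝ}
    (h : NIAC (fun k x a => μ x * p k x a) u c) (k : K) :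
    reconCost μ p u c (p k) ≤ c k := by
  refine maxOver_le fun j => ?_
  have h_swap : JA μ (p k) (u j) - c k - (∑ x, ∑ a, μ x * p j x a * u j x a) + c j ≤ 0 := h k j
  linarith [sum_mul_le_JA μ (p j) (u j)]

/-- Relative optimality (NIAS + NIAC) implies global optimality wrt the
reconstructed cost. -/
theorem relative_implies_global {X A K : Type*} [Fintype X] [Nonempty X]
    [Fintype A] [Nonempty A] [Fintype K] [Nonempty K]
    (μ : X → ℝ) (hμ : IsPrior μ)
    (p : K → X → A → ℝ) (hp : ∀ k, IsKernel (p k))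
    (u : K → X → A → ℝ) (c : K → ℝ)
    (hNIAS : ∀ k, NIAS (fun x a => μ x * p k x a) (u k))
    (hNIAC : NIAC (fun k x a => μ x * p k x a) u c) :
    ∀ k, ∀ p' : X → A → ℝ, IsKernel p' →
      JA μ p' (u k) - reconCost μ p u c p' ≤ JA μ (p k) (u k) - reconCost μ p u c (p k) := by
  intro k p' _
  have h_cost : c k + JA μ p' (u k) - JA μ (p k) (u k) ≤ reconCost μ p u c p' :=
    le_maxOver (fun j => c j + JA μ p' (u j) - JA μ (p j) (u j)) k
  linarith [reconCost_le_of_NIAC hNIAC k]
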